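/- Let r ∈ [0, 2/π], let n₁,…,n_n be unit vectors in ℝ² and α₁,…,α_n ≥ 0 with Σᵢ αᵢ = 1 and Σᵢ αᵢ nᵢ = 0. If the closed ball of radius r centered at the origin is contained in the compatible region m = {2·Σᵢ qᵢ αᵢ nᵢ : 0 ≤ qᵢ ≤ 1, Σᵢ qᵢ αᵢ = 1/2} ⊆ ℝ², then n ≥ √(π/6)·(2/π − r)^{−1/2}. (Lower bound on the planar compatibility complexity N^p(r).) -/

import Mathlib

open Real

/-- The compatible region of a `k`-outcome POVM with rank-one effect directions
`n i` and weights `α i`. -/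
def compatRegion {d k : ℕ} (α : Fin k → ℝ) (n : Fin k → EuclideanSpace ℝ (Fin d)) :
    Set (EuclideanSpace ℝ (Fin d)) :=
  {x | ∃ q : Fin k → ℝ, (∀ i, 0 ≤ q i ∧ q i ≤ 1) ∧
    (∑ i, q i * α i = 1 / 2) ∧ x = ∑ i, (2 * (q i * α i)) • n i}

lemma aux_sin_ge {y : ℝ} (h0 : 0 ≤ y) (h1 : y ≤ π / 2) : y * cos y ≤ sin y := by
  rcases eq_or_lt_of_le h1 with h | h
  · subst h; simp
  · have hc : 0 < cos y := cos_pos_of_mem_Ioo ⟨by linarith [pi_pos], h⟩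
    have := Real.le_tan h0 h
    rw [tan_eq_sin_div_cos, le_div_iff₀ hc] at this
    exact this

lemma aux_tan {y : ℝ} (h0 : 0 ≤ y) (h1 : y ≤ π / 2) :
    3 * y * cos y ≤ (3 - y ^ 2) * sin y := by
  have hd : ∀ x : ℝ, HasDerivAt (fun x : ℝ => (3 - x ^ 2) * sin x - 3 * x * cos x)
      (x * (sin x - x * cos x)) x := by
    intro x
    have h1 := ((((hasDerivAt_id x).pow 2).const_sub 3).mul (hasDerivAt_sin x)).sub
      (((hasDerivAt_id x).const_mul 3).mul (hasDerivAt_cos x))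
    refine (h1.congr_deriv ?_)
    simp
    ring
  have hm : MonotoneOn (fun x : ℝ => (3 - x ^ 2) * sin x - 3 * x * cos x)
      (Set.Icc 0 (π / 2)) := by
    apply monotoneOn_of_deriv_nonneg (convex_Icc _ _)
    · exact fun x _ => (hd x).continuousAt.continuousWithinAt
    · exact fun x _ => (hd x).differentiableAt.differentiableWithinAt
    · intro x hx
      rw [interior_Icc] at hx
      rw [(hd x).deriv]
      have := aux_sin_ge hx.1.le hx.2.le
      exact mul_nonneg hx.1.le (by linarith)
  have := hm (Set.left_mem_Icc.2 (by positivity)) (Set.mem_Icc.2 ⟨h0, h1⟩) h0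
  simp at this
  linarith

lemma aux_jensen {x y : ℝ} (hx : 0 ≤ x) (hy : 0 ≤ y) (hx3 : x ^ 2 < 3) (hy3 : y ^ 2 < 3) :
    3 * x / (3 - x ^ 2) + 3 * (3 + x ^ 2) / (3 - x ^ 2) ^ 2 * (y - x) ≤ 3 * y / (3 - y ^ 2) := by
  have hX : 0 < 3 - x ^ 2 := by linarith
  have hY : 0 < 3 - y ^ 2 := by linarith
  have key : 3 * y / (3 - y ^ 2) -
      (3 * x / (3 - x ^ 2) + 3 * (3 + x ^ 2) / (3 - x ^ 2) ^ 2 * (y - x))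
      = (y - x) ^ 2 * (9 * (y + 2 * x) + 3 * x ^ 2 * y) / ((3 - x ^ 2) ^ 2 * (3 - y ^ 2)) := by
    field_simp
    ring
  have : 0 ≤ (y - x) ^ 2 * (9 * (y + 2 * x) + 3 * x ^ 2 * y) /
      ((3 - x ^ 2) ^ 2 * (3 - y ^ 2)) := by positivity
  linarith

lemma aux_sq {y : ℝ} (h0 : 0 ≤ y) (h1 : y ≤ π / 2) : y ^ 2 < 3 := by
  have := pi_lt_d2
  nlinarith

lemma aux_step {a b : ℝ} (ha : 0 ≤ a) (hab : a ≤ b) (hb : b ≤ π) :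
    3 * ((b - a) / 2) / (3 - ((b - a) / 2) ^ 2) * (sin a + sin b) ≤ cos a - cos b := by
  have h0 : 0 ≤ (b - a) / 2 := by linarith
  have h1 : (b - a) / 2 ≤ π / 2 := by linarith
  have hs : 0 ≤ sin ((a + b) / 2) := sin_nonneg_of_nonneg_of_le_pi (by linarith) (by linarith)
  have ht := aux_tan h0 h1
  have hq := aux_sq h0 h1
  have e1 : sin a + sin b = 2 * sin ((a + b) / 2) * cos ((b - a) / 2) := by
    have e : a = (a + b) / 2 - (b - a) / 2 := by ring
    have e' : b = (a + b) / 2 + (b - a) / 2 := by ring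
    generalize (a + b) / 2 = p at *
    generalize (b - a) / 2 = s at *
    rw [e, e', sin_sub, sin_add]; ring
  have e2 : cos a - cos b = 2 * sin ((a + b) / 2) * sin ((b - a) / 2) := by
    have e : a = (a + b) / 2 - (b - a) / 2 := by ring
    have e' : b = (a + b) / 2 + (b - a) / 2 := by ring
    generalize (a + b) / 2 = p at *
    generalize (b - a) / 2 = s at *
    rw [e, e', cos_sub, cos_add]; ring
  rw [e1, e2]
  generalize (b - a) / 2 = s at *
  generalize sin ((a + b) / 2) = p at *
  rw [div_mul_eq_mul_div, div_le_iff₀ (by linarith)]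
  nlinarith [mul_le_mul_of_nonneg_left ht hs]

lemma aux_core {n : ℕ} (hn : 0 < n) (T : ℕ → ℝ) (hT : Monotone T) (hTn : T n = T 0 + π)
    (α : Fin n → ℝ) (hα : ∀ i, 0 ≤ α i) (hαsum : ∑ i, α i = 1) (r : ℝ) (hr0 : 0 ≤ r)
    (hr : ∀ t, r ≤ ∑ j, α j * |sin (t - T j)|) : r ≤ 2 / π - π / (6 * (n : ℝ) ^ 2) := by
  have hn1 : (1 : ℝ) ≤ n := by exact_mod_cast hn
  have hpi := pi_pos
  set y : ℕ → ℝ := fun i => (T (i + 1) - T i) / 2 with hy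
  set g : ℕ → ℝ := fun i => 3 * y i / (3 - y i ^ 2) with hg
  have hbd : ∀ i ≤ n, T 0 ≤ T i ∧ T i ≤ T 0 + π :=
    fun i hi => ⟨hT (Nat.zero_le i), hTn ▸ hT hi⟩
  have hy0 : ∀ i < n, 0 ≤ y i ∧ y i ≤ π / 2 := by
    intro i hi
    have h1 := hbd i hi.le
    have h2 := hbd (i + 1) hi
    have h3 := hT (Nat.le_succ i)
    simp only [hy, Nat.succ_eq_add_one] at *
    constructor <;> linarith
  have hg0 : ∀ i < n, 0 ≤ g i := by
    intro i hi
    have h := hy0 i hi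
    have := aux_sq h.1 h.2
    exact div_nonneg (by linarith [h.1]) (by linarith)
  -- each generator contributes at most two
  have hone : ∀ j : Fin n, ∑ i ∈ Finset.range n,
      g i * (|sin (T i - T j)| + |sin (T (i + 1) - T j)|) ≤ 2 := by
    intro j
    have hj := hbd j j.2.le
    let G : ℕ → ℝ := fun i => if i ≤ (j : ℕ) then cos (T i - T j) - 1 else 1 - cos (T i - T j)
    have hG : ∑ i ∈ Finset.range n, (G (i + 1) - G i) = 2 := by
      rw [Finset.sum_range_sub]
      have : ¬ n ≤ (j : ℕ) := by have := j.2; omega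
      simp only [G, this, if_false, Nat.zero_le, if_true, hTn]
      have : T 0 + π - T j = (T 0 - T j) + π := by ring
      rw [this, cos_add_pi]; ring
    rw [← hG]
    apply Finset.sum_le_sum
    intro i hi
    have hi := Finset.mem_range.1 hi
    have h1 := hbd i hi.le
    have h2 := hbd (i + 1) hi
    have h3 := hT (Nat.le_succ i)
    by_cases hij : (j : ℕ) ≤ i
    · have h4 := hT hij
      have st := aux_step (a := T i - T j) (b := T (i + 1) - T j) (by linarith)
        (by simp only [Nat.succ_eq_add_one] at h3; linarith) (by linarith)
      have e : (T (i + 1) - T j - (T i - T j)) / 2 = y i := by simp only [hy]; ring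
      rw [e] at st
      simp only [Nat.succ_eq_add_one] at h3
      rw [abs_of_nonneg (sin_nonneg_of_nonneg_of_le_pi (by linarith) (by linarith)),
        abs_of_nonneg (sin_nonneg_of_nonneg_of_le_pi (by linarith) (by linarith))]
      have e1 : G (i + 1) = 1 - cos (T (i + 1) - T j) := by
        simp only [G]; rw [if_neg (by omega)]
      have e2 : G i = 1 - cos (T i - T j) := by
        simp only [G]
        split_ifs with h
        · have : i = (j : ℕ) := by omega
          rw [this]; simp
        · rfl
      rw [e1, e2]
      simp only [hg]
      linarith
    · have h4 : T (i + 1) ≤ T j := hT (by omega)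
      simp only [Nat.succ_eq_add_one] at h3
      have st := aux_step (a := T j - T (i + 1)) (b := T j - T i) (by linarith)
        (by linarith) (by linarith)
      have e : (T j - T i - (T j - T (i + 1))) / 2 = y i := by simp only [hy]; ring
      rw [e] at st
      have s1 : |sin (T i - T j)| = sin (T j - T i) := by
        rw [← neg_sub, sin_neg, abs_neg]
        exact abs_of_nonneg (sin_nonneg_of_nonneg_of_le_pi (by linarith) (by linarith))
      have s2 : |sin (T (i + 1) - T j)| = sin (T j - T (i + 1)) := by
        rw [← neg_sub, sin_neg, abs_neg]
        exact abs_of_nonneg (sin_nonneg_of_nonneg_of_le_pi (by linarith) (by linarith))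
      have e1 : G (i + 1) = cos (T j - T (i + 1)) - 1 := by
        simp only [G]; rw [if_pos (by omega), ← neg_sub (T j), cos_neg]
      have e2 : G i = cos (T j - T i) - 1 := by
        simp only [G]; rw [if_pos (by omega), ← neg_sub (T j), cos_neg]
      rw [e1, e2, s1, s2]
      simp only [hg]
      linarith
  have htot : r * ∑ i ∈ Finset.range n, g i ≤ 1 := by
    have h1 : ∑ i ∈ Finset.range n, g i * (r + r) ≤ ∑ i ∈ Finset.range n,
        g i * (∑ j, α j * |sin (T i - T j)| + ∑ j, α j * |sin (T (i + 1) - T j)|) := by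
      apply Finset.sum_le_sum
      intro i hi
      exact mul_le_mul_of_nonneg_left (add_le_add (hr _) (hr _)) (hg0 i (Finset.mem_range.1 hi))
    have h2 : ∑ i ∈ Finset.range n,
        g i * (∑ j, α j * |sin (T i - T j)| + ∑ j, α j * |sin (T (i + 1) - T j)|)
        = ∑ j, α j * ∑ i ∈ Finset.range n,
          g i * (|sin (T i - T j)| + |sin (T (i + 1) - T j)|) := by
      simp_rw [← Finset.sum_add_distrib, Finset.mul_sum]
      rw [Finset.sum_comm]
      refine Finset.sum_congr rfl fun j _ => Finset.sum_congr rfl fun i _ => by ring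
    have h3 : ∑ j, α j * ∑ i ∈ Finset.range n,
          g i * (|sin (T i - T j)| + |sin (T (i + 1) - T j)|) ≤ ∑ j, α j * 2 :=
      Finset.sum_le_sum fun j _ => mul_le_mul_of_nonneg_left (hone j) (hα j)
    rw [← Finset.sum_mul, hαsum] at h3
    rw [← Finset.sum_mul] at h1
    linarith
  set x : ℝ := π / (2 * n) with hx
  have hx0 : 0 < x := by positivity
  have hxn : n * x = π / 2 := by rw [hx]; field_simp
  have hx1 : x ≤ π / 2 := by nlinarith
  have hx3 := aux_sq hx0.le hx1
  have hX : 0 < 3 - x ^ 2 := by linarith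
  have hsum : n * (3 * x / (3 - x ^ 2)) ≤ ∑ i ∈ Finset.range n, g i := by
    have hle : ∑ i ∈ Finset.range n,
        (3 * x / (3 - x ^ 2) + 3 * (3 + x ^ 2) / (3 - x ^ 2) ^ 2 * (y i - x))
        ≤ ∑ i ∈ Finset.range n, g i := by
      apply Finset.sum_le_sum
      intro i hi
      have h := hy0 i (Finset.mem_range.1 hi)
      exact aux_jensen hx0.le h.1 hx3 (aux_sq h.1 h.2)
    have hys : ∑ i ∈ Finset.range n, (y i - x) = 0 := by
      rw [Finset.sum_sub_distrib]
      simp only [hy]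
      rw [← Finset.sum_div, Finset.sum_range_sub, hTn]
      simp only [Finset.sum_const, Finset.card_range, nsmul_eq_mul]
      linarith
    rw [Finset.sum_add_distrib, ← Finset.mul_sum, hys] at hle
    simp only [Finset.sum_const, Finset.card_range, nsmul_eq_mul] at hle
    linarith
  have hfin : r * (n * (3 * x / (3 - x ^ 2))) ≤ 1 :=
    (mul_le_mul_of_nonneg_left hsum hr0).trans htot
  have e : r * (n * (3 * x / (3 - x ^ 2))) = r * (3 * (π / 2)) / (3 - x ^ 2) := by
    rw [← hxn]; ring
  rw [e, div_le_one hX] at hfin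
  have e2 : 2 / π - π / (6 * (n : ℝ) ^ 2) = (3 - x ^ 2) / (3 * (π / 2)) := by
    rw [hx]; field_simp; ring
  rw [e2, le_div_iff₀ (by positivity)]
  exact hfin

lemma aux_angle (w : EuclideanSpace ℝ (Fin 2)) (hw : ‖w‖ = 1) :
    ∃ θ : ℝ, 0 ≤ θ ∧ θ ≤ π ∧ ∀ t, |cos t * w 1 - sin t * w 0| = |sin (t - θ)| := by
  have h : w 0 ^ 2 + w 1 ^ 2 = 1 := by
    have := EuclideanSpace.real_norm_sq_eq w
    rw [hw, Fin.sum_univ_two] at this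
    linarith
  have hlo : -1 ≤ w 0 := by nlinarith [sq_nonneg (w 1)]
  have hhi : w 0 ≤ 1 := by nlinarith [sq_nonneg (w 1)]
  have hs : √(1 - w 0 ^ 2) = |w 1| := by
    rw [← Real.sqrt_sq_eq_abs]; congr 1; linarith
  rcases le_total 0 (w 1) with h1 | h1
  · refine ⟨arccos (w 0), arccos_nonneg _, arccos_le_pi _, fun t => ?_⟩
    rw [sin_sub, cos_arccos hlo hhi, sin_arccos, hs, abs_of_nonneg h1, ← abs_neg]
    congr 1; ring
  · refine ⟨arccos (-w 0), arccos_nonneg _, arccos_le_pi _, fun t => ?_⟩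
    rw [sin_sub, cos_arccos (by linarith) (by linarith), sin_arccos, neg_sq, hs,
      abs_of_nonpos h1]
    congr 1; ring

theorem planar_complexity_lower_bound
    (r : ℝ) (hr0 : 0 ≤ r) (hr1 : r ≤ 2 / π)
    (n : ℕ) (v : Fin n → EuclideanSpace ℝ (Fin 2)) (hv : ∀ i, ‖v i‖ = 1)
    (α : Fin n → ℝ) (hα : ∀ i, 0 ≤ α i) (hαsum : ∑ i, α i = 1)
    (hcomplete : ∑ i, α i • v i = 0)
    (hball : Metric.closedBall (0 : EuclideanSpace ℝ (Fin 2)) r ⊆ compatRegion α v) :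
    Real.sqrt (π / 6) * (2 / π - r) ^ (-(1 / 2 : ℝ)) ≤ (n : ℝ) := by
  have hn : 0 < n := by
    rcases Nat.eq_zero_or_pos n with h | h
    · subst h; simp at hαsum
    · exact h
  have hpi := pi_pos
  choose θ hθ0 hθ1 hθ using fun i => aux_angle (v i) (hv i)
  -- support function estimate
  have hsup : ∀ t, r ≤ ∑ j, α j * |sin (t - θ j)| := by
    intro t
    let u : EuclideanSpace ℝ (Fin 2) := !₂[-(r * sin t), r * cos t]
    have hu : u ∈ Metric.closedBall (0 : EuclideanSpace ℝ (Fin 2)) r := by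
      rw [mem_closedBall_zero_iff]
      apply le_of_sq_le_sq _ hr0
      rw [EuclideanSpace.real_norm_sq_eq, Fin.sum_univ_two]
      simp only [u, Matrix.cons_val_zero, Matrix.cons_val_one]
      have := sin_sq_add_cos_sq t
      simp
      nlinarith
    obtain ⟨q, hq, -, hqu⟩ := hball hu
    have c : ∀ k, ∑ i, α i * v i k = 0 := by
      intro k
      have := congrArg (fun w : EuclideanSpace ℝ (Fin 2) => w k) hcomplete
      simpa using this
    have d0 : -(r * sin t) = ∑ i, 2 * (q i * α i) * v i 0 := by
      have := congrArg (fun w : EuclideanSpace ℝ (Fin 2) => w 0) hqu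
      simpa [u] using this
    have d1 : r * cos t = ∑ i, 2 * (q i * α i) * v i 1 := by
      have := congrArg (fun w : EuclideanSpace ℝ (Fin 2) => w 1) hqu
      simpa [u] using this
    have e : r = ∑ i, (2 * q i - 1) * (α i * (cos t * v i 1 - sin t * v i 0)) := by
      have e1 : ∑ i, (2 * q i - 1) * (α i * (cos t * v i 1 - sin t * v i 0))
          = cos t * (∑ i, 2 * (q i * α i) * v i 1) - sin t * (∑ i, 2 * (q i * α i) * v i 0)
            - cos t * (∑ i, α i * v i 1) + sin t * (∑ i, α i * v i 0) := by
        simp only [Finset.mul_sum]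
        rw [← Finset.sum_sub_distrib, ← Finset.sum_sub_distrib, ← Finset.sum_add_distrib]
        exact Finset.sum_congr rfl fun i _ => by ring
      rw [e1, c, c, ← d0, ← d1]
      linear_combination (-r) * sin_sq_add_cos_sq t
    rw [e]
    apply Finset.sum_le_sum
    intro i _
    rw [← hθ i t]
    have hq1 : |2 * q i - 1| ≤ 1 := abs_le.2 ⟨by linarith [(hq i).1], by linarith [(hq i).2]⟩
    calc (2 * q i - 1) * (α i * (cos t * v i 1 - sin t * v i 0))
        ≤ |(2 * q i - 1) * (α i * (cos t * v i 1 - sin t * v i 0))| := le_abs_self _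
      _ = |2 * q i - 1| * (α i * |cos t * v i 1 - sin t * v i 0|) := by
          rw [abs_mul, abs_mul, abs_of_nonneg (hα i)]
      _ ≤ 1 * (α i * |cos t * v i 1 - sin t * v i 0|) :=
          mul_le_mul_of_nonneg_right hq1 (mul_nonneg (hα i) (abs_nonneg _))
      _ = _ := one_mul _
  -- sort the angles
  let σ := Tuple.sort θ
  have hσ : Monotone (θ ∘ σ) := Tuple.monotone_sort θ
  let T : ℕ → ℝ := fun i => if h : i < n then θ (σ ⟨i, h⟩) else θ (σ ⟨0, hn⟩) + π
  have hTm : Monotone T := by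
    intro a b hab
    simp only [T]
    split_ifs with h1 h2 h2
    · exact hσ (Fin.mk_le_mk.2 hab)
    · linarith [hθ1 (σ ⟨a, h1⟩), hθ0 (σ ⟨0, hn⟩)]
    · omega
    · exact le_rfl
  have hmain : r ≤ 2 / π - π / (6 * (n : ℝ) ^ 2) := by
    refine aux_core hn T hTm (by simp [T, hn]) (α ∘ σ) (fun i => hα _)
      ((Equiv.sum_comp σ α).trans hαsum) r hr0 (fun t => ?_)
    refine (hsup t).trans (le_of_eq ?_)
    rw [← Equiv.sum_comp σ]
    refine Finset.sum_congr rfl fun i _ => ?_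
    simp [T]
  have hn0 : (0 : ℝ) < n := by exact_mod_cast hn
  have hD : π / (6 * (n : ℝ) ^ 2) ≤ 2 / π - r := by linarith
  have hD0 : 0 < 2 / π - r := lt_of_lt_of_le (by positivity) hD
  rw [Real.rpow_neg hD0.le, ← Real.sqrt_eq_rpow, ← div_eq_mul_inv, ← Real.sqrt_div' _ hD0.le]
  apply Real.sqrt_le_iff.2 ⟨hn0.le, ?_⟩
  rw [div_le_iff₀ hD0]
  calc π / 6 = (n : ℝ) ^ 2 * (π / (6 * (n : ℝ) ^ 2)) := by field_simp
    _ ≤ _ := mul_le_mul_of_nonneg_left hD (by positivity)
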